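/- arXiv:2510.03580 — 4 statements merged into one kernel-verified Lean document; each statement's English description precedes it below -/
import Mathlib

section
/- Every colored set is an admissible pinnacle set in some generalized symmetric group: if S ⊆ I_n^m is nonempty and all elements of S have the same color a ∈ {0,…,m−1}, then there exists a positive integer N with S ⊆ I_N^m such that S is an admissible pinnacle set for Z_m ≀ S_N. -/
open Finset

/-- `Prec p q` means the colored symbol `p = ξ^{p.1}(p.2)` precedes (is smaller than)
`q = ξ^{q.1}(q.2)`: `a > b`, or (`a = b` and `x > y`). -/
def Prec (p q : ℕ × ℕ) : Prop :=
  q.1 < p.1 ∨ (p.1 = q.1 ∧ q.2 < p.2)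

instance : DecidableRel Prec := fun p q => by
  unfold Prec; infer_instance

/-- `w : ℕ → ℕ × ℕ` (read on positions `1,…,n`) is an element of `Z_m ≀ S_n`:
each entry has color `< m` and norm in `{1,…,n}`, and the norms are pairwise distinct. -/
def IsGenPerm (m n : ℕ) (w : ℕ → ℕ × ℕ) : Prop :=
  (∀ i ∈ Finset.Icc 1 n, (w i).1 < m ∧ (w i).2 ∈ Finset.Icc 1 n) ∧
    Set.InjOn (fun i => (w i).2) (Set.Icc 1 n)

/-- The pinnacle set of the word `w`: values at interior positions `2 ≤ i ≤ n-1`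
that strictly dominate both neighbors. -/
def pin (n : ℕ) (w : ℕ → ℕ × ℕ) : Finset (ℕ × ℕ) :=
  ((Finset.Icc 2 (n - 1)).filter
      (fun i => Prec (w (i - 1)) (w i) ∧ Prec (w (i + 1)) (w i))).image w

/-- `P` is an admissible pinnacle set for `Z_m ≀ S_n`. -/
def IsAdmissible (m n : ℕ) (P : Finset (ℕ × ℕ)) : Prop :=
  ∃ w, IsGenPerm m n w ∧ pin n w = P

/-- `APS m n d` : admissible pinnacle sets for `Z_m ≀ S_n` of cardinality at most `d`. -/
def APS (m n d : ℕ) : Set (Finset (ℕ × ℕ)) :=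
  {P | IsAdmissible m n P ∧ P.card ≤ d}

/-- Every finite set of naturals is enumerated increasingly by `0, …, |C| - 1`. -/
theorem exists_increasing_enumeration (C : Finset ℕ) :
    ∃ f : ℕ → ℕ, (∀ i j, i < j → j < C.card → f i < f j) ∧
      (∀ i < C.card, f i ∈ C) ∧ ∀ x ∈ C, ∃ i < C.card, f i = x := by
  have hfin : {x | x ∈ C}.Finite := C.finite_toSet
  have hcard : hfin.toFinset.card = C.card := by
    congr 1
    ext x
    simp
  refine ⟨Nat.nth (· ∈ C), fun i j hij hj => ?_, fun i hi => ?_, fun x hx => ?_⟩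
  · exact Nat.nth_lt_nth' hij fun _ => hcard ▸ hj
  · exact Nat.nth_mem i fun _ => hcard ▸ hi
  · obtain ⟨i, hi, h⟩ := Nat.exists_lt_card_finite_nth_eq (p := (· ∈ C)) hfin hx
    exact ⟨i, hcard ▸ hi, h⟩

/-- The word listing `u 0, …, u (c - 1)` at positions `1, …, c`, followed by
`n + 1, s 0, n + 2, s 1, …`. -/
def zigzag (n c : ℕ) (u s : ℕ → ℕ) (i : ℕ) : ℕ :=
  if i ≤ c then u (i - 1)
  else if (i - c) % 2 = 1 then n + 1 + (i - c - 1) / 2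
  else s ((i - c) / 2 - 1)

theorem zigzag_initial {n c : ℕ} {u s : ℕ → ℕ} {i : ℕ} (hi : i < c) :
    zigzag n c u s (i + 1) = u i := by
  simp [zigzag, Nat.succ_le_of_lt hi]

theorem zigzag_large {n c : ℕ} {u s : ℕ → ℕ} (j : ℕ) :
    zigzag n c u s (c + 1 + 2 * j) = n + 1 + j := by
  rw [zigzag, if_neg (by omega), if_pos (by omega)]
  omega

theorem zigzag_pinnacle {n c : ℕ} {u s : ℕ → ℕ} (j : ℕ) :
    zigzag n c u s (c + 2 + 2 * j) = s j := by
  rw [zigzag, if_neg (by omega), if_neg (by omega)]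
  congr 1
  omega

theorem zigzag_position {c k i : ℕ} (h1 : 1 ≤ i) (h2 : i ≤ c + 2 * k + 1) :
    (∃ j < c, i = j + 1) ∨ (∃ j ≤ k, i = c + 1 + 2 * j) ∨ ∃ j < k, i = c + 2 + 2 * j := by
  by_cases hc : i ≤ c
  · exact Or.inl ⟨i - 1, by omega, by omega⟩
  · rcases Nat.even_or_odd' (i - c) with ⟨j, hj | hj⟩
    · exact Or.inr (Or.inr ⟨j - 1, by omega, by omega⟩)
    · exact Or.inr (Or.inl ⟨j, by omega, by omega⟩)

/-- Every nonempty colored set `S ⊆ I_n^m` (all elements of the same color `a < m`)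
is an admissible pinnacle set for `Z_m ≀ S_N` for some positive `N` with `S ⊆ I_N^m`. -/
theorem colored_set_admissible (m n a : ℕ) (hm : 1 ≤ m) (hn : 1 ≤ n) (ha : a < m)
    (S : Finset (ℕ × ℕ)) (hS : ∀ p ∈ S, p.1 = a ∧ 1 ≤ p.2 ∧ p.2 ≤ n)
    (hne : S.Nonempty) :
    ∃ N : ℕ, 1 ≤ N ∧ (∀ p ∈ S, p.2 ≤ N) ∧ IsAdmissible m N S := by
  classical
  set T : Finset ℕ := S.image Prod.snd with hT
  set C : Finset ℕ := Finset.Icc 1 n \ T with hC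
  have hTS : ∀ x, x ∈ T ↔ (a, x) ∈ S := by
    intro x
    simp only [hT, Finset.mem_image, Prod.exists, exists_eq_right]
    exact ⟨fun ⟨b, hb⟩ => (hS _ hb).1 ▸ hb, fun h => ⟨a, h⟩⟩
  have hTn : T ⊆ Finset.Icc 1 n := fun x hx =>
    Finset.mem_Icc.2 (hS _ ((hTS x).1 hx)).2
  have hcard : C.card + T.card = n := by
    simpa using Finset.card_sdiff_add_card_eq_card hTn
  obtain ⟨u, hu, huC, -⟩ := exists_increasing_enumeration C
  obtain ⟨s, hs, hsT, hsurj⟩ := exists_increasing_enumeration T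
  set c := C.card
  set k := T.card
  have hun : ∀ i < c, 1 ≤ u i ∧ u i ≤ n := fun i hi =>
    Finset.mem_Icc.1 (Finset.mem_sdiff.1 (huC i hi)).1
  have hsn : ∀ i < k, 1 ≤ s i ∧ s i ≤ n := fun i hi =>
    Finset.mem_Icc.1 (hTn (hsT i hi))
  have hus : ∀ i < c, ∀ j < k, u i ≠ s j := fun i hi j hj h =>
    (Finset.mem_sdiff.1 (huC i hi)).2 (h ▸ hsT j hj)
  have huinj : ∀ i < c, ∀ j < c, u i = u j → i = j := by
    intro i hi j hj h
    rcases lt_trichotomy i j with hij | hij | hij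
    · have := hu i j hij hj
      omega
    · exact hij
    · have := hu j i hij hi
      omega
  have hsinj : ∀ i < k, ∀ j < k, s i = s j → i = j := by
    intro i hi j hj h
    rcases lt_trichotomy i j with hij | hij | hij
    · have := hs i j hij hj
      omega
    · exact hij
    · have := hs j i hij hi
      omega
  set w : ℕ → ℕ := zigzag n c u s
  have hw1 : ∀ i < c, w (i + 1) = u i := fun i hi => zigzag_initial hi
  have hw2 : ∀ j, w (c + 1 + 2 * j) = n + 1 + j := zigzag_large
  have hw3 : ∀ j, w (c + 2 + 2 * j) = s j := zigzag_pinnacle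
  refine ⟨c + 2 * k + 1, by omega, fun p hp => ?_, fun i => (a, w i),
    ⟨fun i hi => ⟨ha, ?_⟩, ?_⟩, ?_⟩
  · have := (hS p hp).2.2
    omega
  · rw [Finset.mem_Icc] at hi ⊢
    rcases zigzag_position hi.1 hi.2 with ⟨j, hj, rfl⟩ | ⟨j, hj, rfl⟩ | ⟨j, hj, rfl⟩
    · have := hun j hj
      simp only [hw1 j hj]
      omega
    · simp only [hw2]
      omega
    · have := hsn j hj
      simp only [hw3]
      omega
  · intro x hx y hy hxy
    simp only at hxy
    rcases zigzag_position hx.1 hx.2 with ⟨i, hi, rfl⟩ | ⟨i, hi, rfl⟩ | ⟨i, hi, rfl⟩ <;>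
      rcases zigzag_position hy.1 hy.2 with ⟨j, hj, rfl⟩ | ⟨j, hj, rfl⟩ | ⟨j, hj, rfl⟩ <;>
      simp only [hw1, hw2, hw3, hi, hj] at hxy <;> grind
  · ext ⟨b, x⟩
    simp only [pin, Prec, Finset.mem_image, Finset.mem_filter, Finset.mem_Icc, lt_irrefl,
      false_or, true_and, Prod.mk.injEq]
    constructor
    · rintro ⟨i, ⟨hi, hl, hr⟩, rfl, rfl⟩
      rcases zigzag_position (c := c) (k := k) (i := i) (by omega) (by omega) with
        ⟨j, hj, rfl⟩ | ⟨j, hj, rfl⟩ | ⟨j, hj, rfl⟩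
      · obtain ⟨l, rfl⟩ : ∃ l, j = l + 1 := ⟨j - 1, by omega⟩
        rw [Nat.add_sub_cancel, hw1 _ hj, hw1 l (by omega)] at hl
        have := hu l (l + 1) (by omega) hj
        omega
      · have hnext : c + 1 + 2 * j + 1 = c + 2 + 2 * j := by ring
        have := hsn j (by omega)
        rw [hnext, hw3, hw2] at hr
        omega
      · rw [hw3]
        exact (hTS _).1 (hsT j hj)
    · intro hx
      obtain rfl : b = a := (hS _ hx).1
      obtain ⟨j, hj, rfl⟩ := hsurj x ((hTS x).2 hx)
      have hprev : c + 2 + 2 * j - 1 = c + 1 + 2 * j := by omega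
      have hnext : c + 2 + 2 * j + 1 = c + 1 + 2 * (j + 1) := by ring
      have := hsn j hj
      refine ⟨c + 2 + 2 * j, ⟨by omega, ?_, ?_⟩, rfl, hw3 j⟩
      · rw [hprev, hw2, hw3]
        omega
      · rw [hnext, hw2, hw3]
        omega
end

section
/- Let m ≥ 3 and let i be an integer with 1 ≤ i < m−1. If P ⊆ I_n^m is a set all of whose elements have color i and #P ≤ ⌊(n−1)/2⌋, then P is an admissible pinnacle set for Z_m ≀ S_n (so P ∈ APS_{#P}(m,n)). -/
open Finset

/-- The elements of a finite set of naturals, listed in strictly decreasing order. -/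
lemma exists_strictAntiOn_enum (S : Finset ℕ) :
    ∃ g : ℕ → ℕ, (∀ j < S.card, g j ∈ S) ∧ (∀ j l, j < l → l < S.card → g l < g j) ∧
      ∀ x ∈ S, ∃ j < S.card, g j = x := by
  refine ⟨fun j => if h : j < S.card then S.orderEmbOfFin rfl (Fin.rev ⟨j, h⟩) else 0,
    ?_, ?_, ?_⟩
  · intro j hj
    simp only [hj, dif_pos]
    exact S.orderEmbOfFin_mem rfl _
  · intro j l hjl hl
    simp only [hl, hjl.trans hl, dif_pos]
    apply (S.orderEmbOfFin rfl).strictMono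
    simpa [Fin.rev_lt_rev] using hjl
  · intro x hx
    have hx' : x ∈ Set.range (S.orderEmbOfFin rfl) := by simpa using hx
    obtain ⟨j, rfl⟩ := hx'
    exact ⟨(Fin.rev j).val, (Fin.rev j).isLt, by
      simp only [Fin.is_lt, dif_pos, Fin.eta, Fin.rev_rev]⟩

/-- The word with entries of color `i` and norms `a 0, …, a (k - 1)` at positions `2, 4, …, 2k`,
and entries of color `c` and norms `b 0, b 1, …` at the remaining positions. -/
def interleave (k i c : ℕ) (a b : ℕ → ℕ) (j : ℕ) : ℕ × ℕ :=
  if j % 2 = 0 ∧ j ≤ 2 * k then (i, a (j / 2 - 1))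
  else (c, b (if j ≤ 2 * k + 1 then j / 2 else j - k - 1))

lemma interleave_peak {k i c : ℕ} (a b : ℕ → ℕ) {j : ℕ} (h : j % 2 = 0 ∧ j ≤ 2 * k) :
    interleave k i c a b j = (i, a (j / 2 - 1)) := if_pos h

lemma interleave_valley {k i c : ℕ} (a b : ℕ → ℕ) {j : ℕ} (h : ¬(j % 2 = 0 ∧ j ≤ 2 * k)) :
    interleave k i c a b j = (c, b (if j ≤ 2 * k + 1 then j / 2 else j - k - 1)) := if_neg h

/-- If `m ≥ 3`, `1 ≤ i < m - 1`, and `P ⊆ I_n^m` has all elements of color `i`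
with `#P ≤ ⌊(n-1)/2⌋`, then `P ∈ APS_{#P}(m, n)`. -/
theorem colored_middle_admissible (m n i : ℕ) (hm : 3 ≤ m) (hn : 1 ≤ n)
    (hi1 : 1 ≤ i) (hi2 : i < m - 1)
    (P : Finset (ℕ × ℕ)) (hP : ∀ p ∈ P, p.1 = i ∧ 1 ≤ p.2 ∧ p.2 ≤ n)
    (hcard : P.card ≤ (n - 1) / 2) :
    P ∈ APS m n P.card := by
  refine ⟨?_, le_rfl⟩
  have hSP : (P.image Prod.snd).card = P.card := by
    apply Finset.card_image_of_injOn
    intro p hp q hq h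
    exact Prod.ext ((hP p hp).1.trans (hP q hq).1.symm) h
  have hmemS : ∀ x, x ∈ P.image Prod.snd ↔ (i, x) ∈ P := by
    intro x
    simp only [Finset.mem_image, Prod.exists, exists_eq_right]
    constructor
    · rintro ⟨c, hc⟩
      obtain rfl : c = i := (hP _ hc).1
      exact hc
    · exact fun h => ⟨i, h⟩
  have hsub : P.image Prod.snd ⊆ Finset.Icc 1 n := by
    intro x hx
    exact Finset.mem_Icc.2 (hP _ ((hmemS x).1 hx)).2
  have hT : (Finset.Icc 1 n \ P.image Prod.snd).card = n - P.card := by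
    rw [Finset.card_sdiff_of_subset hsub, hSP, Nat.card_Icc, Nat.add_sub_cancel]
  obtain ⟨a, ha, ha_anti, ha_surj⟩ := exists_strictAntiOn_enum (P.image Prod.snd)
  obtain ⟨b, hb, hb_anti, -⟩ := exists_strictAntiOn_enum (Finset.Icc 1 n \ P.image Prod.snd)
  rw [hSP] at ha ha_anti ha_surj
  rw [hT] at hb hb_anti
  have ha_inj : ∀ j l, j < P.card → l < P.card → a j = a l → j = l := by
    intro j l hj hl h
    rcases lt_trichotomy j l with h' | h' | h'
    · have := ha_anti j l h' hl; omega
    · exact h'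
    · have := ha_anti l j h' hj; omega
  have hb_inj : ∀ j l, j < n - P.card → l < n - P.card → b j = b l → j = l := by
    intro j l hj hl h
    rcases lt_trichotomy j l with h' | h' | h'
    · have := hb_anti j l h' hl; omega
    · exact h'
    · have := hb_anti l j h' hj; omega
  have hab : ∀ j l, j < P.card → l < n - P.card → a j ≠ b l := by
    intro j l hj hl h
    exact (Finset.mem_sdiff.1 (hb l hl)).2 (h ▸ ha j hj)
  set k := P.card
  clear_value k
  refine ⟨interleave k i (m - 1) a b, ⟨?_, ?_⟩, ?_⟩
  · intro j hj
    rw [Finset.mem_Icc] at hj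
    by_cases h : j % 2 = 0 ∧ j ≤ 2 * k
    · rw [interleave_peak a b h]
      exact ⟨by dsimp only; omega, hsub (ha _ (by omega))⟩
    · rw [interleave_valley a b h]
      exact ⟨by dsimp only; omega, (Finset.mem_sdiff.1 (hb _ (by split_ifs <;> omega))).1⟩
  · intro j hj l hl hjl
    rw [Set.mem_Icc] at hj hl
    dsimp only at hjl
    by_cases h : j % 2 = 0 ∧ j ≤ 2 * k <;> by_cases h' : l % 2 = 0 ∧ l ≤ 2 * k
    · rw [interleave_peak a b h, interleave_peak a b h'] at hjl
      have := ha_inj _ _ (by omega) (by omega) hjl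
      omega
    · rw [interleave_peak a b h, interleave_valley a b h'] at hjl
      exact absurd hjl (hab _ _ (by omega) (by split_ifs <;> omega))
    · rw [interleave_valley a b h, interleave_peak a b h'] at hjl
      exact absurd hjl.symm (hab _ _ (by omega) (by split_ifs <;> omega))
    · rw [interleave_valley a b h, interleave_valley a b h'] at hjl
      have := hb_inj _ _ (by split_ifs <;> omega) (by split_ifs <;> omega) hjl
      split_ifs at this <;> omega
  · ext p
    simp only [pin, Finset.mem_image, Finset.mem_filter, Finset.mem_Icc]
    constructor
    · rintro ⟨j, ⟨hj, -, hnext⟩, rfl⟩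
      by_cases h : j % 2 = 0 ∧ j ≤ 2 * k
      · rw [interleave_peak a b h]
        exact (hmemS _).1 (ha _ (by omega))
      · exfalso
        rw [interleave_valley a b h] at hnext
        by_cases h' : (j + 1) % 2 = 0 ∧ j + 1 ≤ 2 * k
        · rw [interleave_peak a b h'] at hnext
          rcases hnext with hnext | hnext <;> dsimp only at hnext <;> omega
        · rw [interleave_valley a b h'] at hnext
          have := hb_anti (if j ≤ 2 * k + 1 then j / 2 else j - k - 1)
            (if j + 1 ≤ 2 * k + 1 then (j + 1) / 2 else j + 1 - k - 1)
            (by split_ifs <;> omega) (by split_ifs <;> omega)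
          rcases hnext with hnext | hnext <;> dsimp only at hnext <;> omega
    · intro hp
      obtain ⟨l, hl, hal⟩ := ha_surj p.2 (Finset.mem_image_of_mem _ hp)
      have hw : interleave k i (m - 1) a b (2 * l + 2) = p := by
        rw [interleave_peak a b (by omega)]
        exact Prod.ext (hP p hp).1.symm (by rw [← hal]; dsimp only; congr 1; omega)
      refine ⟨2 * l + 2, ⟨by omega, ?_, ?_⟩, hw⟩ <;>
      · rw [hw, interleave_valley a b (by omega)]
        left
        rw [(hP p hp).1]
        exact hi2
end

section
/- For all integers k ≥ 0 and d ≥ 0, the image of APS_d(m,n) under Ψ_k equals the set of those P ∈ APS_d(m+k,n) all of whose elements have color at least k; that is, Ψ_k(APS_d(m,n)) = { P ∈ APS_d(m+k,n) : every ξ^a(x) ∈ P has a ≥ k }. -/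
open Finset

/-- `Ψ_k` : increase every color by `k`, keeping norms. -/
def PsiSet (k : ℕ) (P : Finset (ℕ × ℕ)) : Finset (ℕ × ℕ) :=
  P.image (fun p => (p.1 + k, p.2))

/-- `ψ_k` : increase the color of every entry of the word by `k`. -/
def psiWord (k : ℕ) (w : ℕ → ℕ × ℕ) : ℕ → ℕ × ℕ :=
  fun i => ((w i).1 + k, (w i).2)

theorem Prec.trans {p q r : ℕ × ℕ} (hpq : Prec p q) (hqr : Prec q r) : Prec p r := by
  unfold Prec at *; omega

theorem Prec.asymm {p q : ℕ × ℕ} (hpq : Prec p q) : ¬ Prec q p := by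
  unfold Prec at *; omega

theorem prec_or_prec {p q : ℕ × ℕ} (h : p.2 ≠ q.2) : Prec p q ∨ Prec q p := by
  unfold Prec; omega

/-- Position `i` of the word `w` of length `n` carries a pinnacle. -/
def IsPeak (n : ℕ) (w : ℕ → ℕ × ℕ) (i : ℕ) : Prop :=
  2 ≤ i ∧ i + 1 ≤ n ∧ Prec (w (i - 1)) (w i) ∧ Prec (w (i + 1)) (w i)

theorem mem_pin {n : ℕ} {w : ℕ → ℕ × ℕ} {p : ℕ × ℕ} :
    p ∈ pin n w ↔ ∃ i, IsPeak n w i ∧ w i = p := by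
  simp only [pin, IsPeak, Finset.mem_image, Finset.mem_filter, Finset.mem_Icc]
  refine exists_congr fun i => and_congr_left fun _ => ?_
  constructor
  · rintro ⟨⟨h₁, h₂⟩, h₃, h₄⟩
    exact ⟨h₁, by omega, h₃, h₄⟩
  · rintro ⟨h₁, h₂, h₃, h₄⟩
    exact ⟨⟨h₁, by omega⟩, h₃, h₄⟩

theorem pin_congr {n : ℕ} {w v : ℕ → ℕ × ℕ} (h : ∀ i, 1 ≤ i → i ≤ n → w i = v i) :
    pin n w = pin n v := by
  ext p
  rw [mem_pin, mem_pin]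
  refine exists_congr fun i => ?_
  by_cases hi : 2 ≤ i ∧ i + 1 ≤ n
  · simp only [IsPeak, h (i - 1) (by omega) (by omega), h i (by omega) (by omega),
      h (i + 1) (by omega) (by omega)]
  · simp only [IsPeak]
    tauto

theorem pin_psiWord (k n : ℕ) (w : ℕ → ℕ × ℕ) :
    pin n (psiWord k w) = PsiSet k (pin n w) := by
  simp only [pin, PsiSet, Finset.image_image, psiWord, Prec, add_lt_add_iff_right,
    add_left_inj]
  rfl

theorem psiSet_card (k : ℕ) (P : Finset (ℕ × ℕ)) : (PsiSet k P).card = P.card :=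
  Finset.card_image_of_injective _ fun p q h => by
    simpa [Prod.ext_iff] using h

/-- The word obtained from `w` by inserting the letter `x` at position `i`. -/
def insertLetter (w : ℕ → ℕ × ℕ) (i : ℕ) (x : ℕ × ℕ) (j : ℕ) : ℕ × ℕ :=
  if j < i then w j else if j = i then x else w (j - 1)

theorem insertLetter_of_lt {w : ℕ → ℕ × ℕ} {i j : ℕ} {x : ℕ × ℕ} (h : j < i) :
    insertLetter w i x j = w j := by
  simp [insertLetter, h]

theorem insertLetter_self {w : ℕ → ℕ × ℕ} {i : ℕ} {x : ℕ × ℕ} :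
    insertLetter w i x i = x := by
  simp [insertLetter]

theorem insertLetter_succ {w : ℕ → ℕ × ℕ} {i j : ℕ} {x : ℕ × ℕ} (h : i ≤ j) :
    insertLetter w i x (j + 1) = w j := by
  simp [insertLetter, show ¬ j + 1 < i by omega, show j + 1 ≠ i by omega]

theorem pin_insertLetter {n i : ℕ} {w : ℕ → ℕ × ℕ} {x : ℕ × ℕ}
    (hself : ¬ IsPeak (n + 1) (insertLetter w i x) i)
    (hlt : ∀ j, j < i → (IsPeak (n + 1) (insertLetter w i x) j ↔ IsPeak n w j))
    (hge : ∀ j, i ≤ j → (IsPeak (n + 1) (insertLetter w i x) (j + 1) ↔ IsPeak n w j)) :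
    pin (n + 1) (insertLetter w i x) = pin n w := by
  ext p
  rw [mem_pin, mem_pin]
  constructor
  · rintro ⟨j, hj, rfl⟩
    rcases lt_trichotomy j i with h | rfl | h
    · exact ⟨j, (hlt j h).1 hj, (insertLetter_of_lt h).symm⟩
    · exact absurd hj hself
    · obtain ⟨j, rfl⟩ : ∃ l, j = l + 1 := ⟨j - 1, by omega⟩
      exact ⟨j, (hge j (by omega)).1 hj, (insertLetter_succ (by omega)).symm⟩
  · rintro ⟨j, hj, rfl⟩
    rcases lt_or_ge j i with h | h
    · exact ⟨j, (hlt j h).2 hj, insertLetter_of_lt h⟩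
    · exact ⟨j + 1, (hge j h).2 hj, insertLetter_succ h⟩

/-- Inserting a letter into a descent, or in front of a smaller first letter, does not change
the pinnacle set. -/
theorem pin_insertLetter_descent {n i : ℕ} {w : ℕ → ℕ × ℕ} {x : ℕ × ℕ} (hi : 1 ≤ i) (hin : i ≤ n)
    (hright : Prec (w i) x) (hleft : 2 ≤ i → Prec x (w (i - 1))) :
    pin (n + 1) (insertLetter w i x) = pin n w := by
  refine pin_insertLetter ?_ ?_ ?_
  · rintro ⟨h₂, -, h, -⟩
    rw [insertLetter_of_lt (by omega), insertLetter_self] at h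
    exact h.asymm (hleft h₂)
  · intro j hj
    rcases Nat.lt_or_ge (j + 1) i with h | h
    · simp only [IsPeak, insertLetter_of_lt hj, insertLetter_of_lt h,
        insertLetter_of_lt (show j - 1 < i by omega)]
      exact and_congr_right fun _ => and_congr_left fun _ => by omega
    · obtain rfl : i = j + 1 := by omega
      simp only [IsPeak, insertLetter_of_lt hj, insertLetter_self,
        insertLetter_of_lt (show j - 1 < j + 1 by omega)]
      refine and_congr_right fun h₂ => ?_
      have hx : Prec x (w j) := hleft (by omega)
      have := hright.trans hx
      simp only [hx, this, and_true]
      exact and_congr_left fun _ => by omega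
  · intro j hj
    rcases hj.eq_or_lt with rfl | h
    · simp only [IsPeak, insertLetter_succ le_rfl, insertLetter_succ (Nat.le_succ_of_le le_rfl),
        Nat.add_sub_cancel, insertLetter_self, hright.asymm]
      refine iff_of_false (by tauto) ?_
      rintro ⟨h₂, -, h, -⟩
      exact h.asymm (hright.trans (hleft h₂))
    · obtain ⟨l, rfl⟩ : ∃ l, j = l + 1 := ⟨j - 1, by omega⟩
      simp only [IsPeak, insertLetter_succ hj, insertLetter_succ (show i ≤ l + 1 + 1 by omega),
        Nat.add_sub_cancel, insertLetter_succ (show i ≤ l by omega)]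
      rw [← and_assoc, ← and_assoc (a := 2 ≤ l + 1)]
      exact and_congr_left fun _ => by omega

/-- Inserting a letter directly after a larger letter which is minimal in the word does not
change the pinnacle set. -/
theorem pin_insertLetter_after_min {n r : ℕ} {w : ℕ → ℕ × ℕ} {x : ℕ × ℕ} (hr : 1 ≤ r) (hrn : r ≤ n)
    (hx : Prec x (w r)) (hmin : ∀ j, 1 ≤ j → j ≤ n → j ≠ r → Prec (w r) (w j)) :
    pin (n + 1) (insertLetter w (r + 1) x) = pin n w := by
  refine pin_insertLetter ?_ ?_ ?_
  · rintro ⟨-, -, h, -⟩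
    rw [Nat.add_sub_cancel, insertLetter_of_lt (by omega), insertLetter_self] at h
    exact h.asymm hx
  · intro j hj
    rcases Nat.lt_or_ge j r with h | h
    · simp only [IsPeak, insertLetter_of_lt hj, insertLetter_of_lt (show j + 1 < r + 1 by omega),
        insertLetter_of_lt (show j - 1 < r + 1 by omega)]
      exact and_congr_right fun _ => and_congr_left fun _ => by omega
    · obtain rfl : r = j := by omega
      simp only [IsPeak, insertLetter_of_lt hj, insertLetter_of_lt (show r - 1 < r + 1 by omega)]
      constructor
      · rintro ⟨h₂, -, h, -⟩
        exact absurd (hmin (r - 1) (by omega) (by omega) (by omega)) h.asymm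
      · rintro ⟨h₂, -, h, -⟩
        exact absurd (hmin (r - 1) (by omega) (by omega) (by omega)) h.asymm
  · intro j hj
    rcases hj.eq_or_lt with rfl | h
    · simp only [IsPeak, insertLetter_succ le_rfl, insertLetter_succ (Nat.le_succ_of_le le_rfl),
        Nat.add_sub_cancel, insertLetter_self]
      constructor
      · rintro ⟨-, h₂, -, h⟩
        exact ⟨by omega, by omega, hmin _ (by omega) (by omega) (by omega), h⟩
      · rintro ⟨-, h₂, h', h⟩
        exact ⟨by omega, by omega, hx.trans h', h⟩
    · obtain ⟨l, rfl⟩ : ∃ l, j = l + 1 := ⟨j - 1, by omega⟩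
      simp only [IsPeak, insertLetter_succ hj,
        insertLetter_succ (show r + 1 ≤ l + 1 + 1 by omega),
        Nat.add_sub_cancel, insertLetter_succ (show r + 1 ≤ l by omega)]
      rw [← and_assoc, ← and_assoc (a := 2 ≤ l + 1)]
      exact and_congr_left fun _ => by omega

/-- A nonempty word with distinct norms has a smallest letter. -/
theorem exists_min_letter {n : ℕ} {w : ℕ → ℕ × ℕ} (hn : 1 ≤ n)
    (hw : Set.InjOn (fun i => (w i).2) (Set.Icc 1 n)) :
    ∃ r, 1 ≤ r ∧ r ≤ n ∧ ∀ j, 1 ≤ j → j ≤ n → j ≠ r → Prec (w r) (w j) := by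
  obtain ⟨r, hr, hmax⟩ := Finset.exists_max_image (Finset.Icc 1 n)
    (fun i => toLex (w i)) ⟨1, by simpa using hn⟩
  rw [Finset.mem_Icc] at hr
  refine ⟨r, hr.1, hr.2, fun j h₁ h₂ hne => ?_⟩
  have hle := hmax j (Finset.mem_Icc.2 ⟨h₁, h₂⟩)
  have hnorm : (w j).2 ≠ (w r).2 := fun h => hne (hw ⟨h₁, h₂⟩ hr h)
  rw [Prod.Lex.le_iff] at hle
  simp only [ofLex_toLex] at hle
  unfold Prec
  omega

/-- A nonempty word with distinct norms has a largest letter. -/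
theorem exists_max_letter {n : ℕ} {w : ℕ → ℕ × ℕ} (hn : 1 ≤ n)
    (hw : Set.InjOn (fun i => (w i).2) (Set.Icc 1 n)) :
    ∃ r, 1 ≤ r ∧ r ≤ n ∧ ∀ j, 1 ≤ j → j ≤ n → j ≠ r → Prec (w j) (w r) := by
  obtain ⟨r, hr, hmin⟩ := Finset.exists_min_image (Finset.Icc 1 n)
    (fun i => toLex (w i)) ⟨1, by simpa using hn⟩
  rw [Finset.mem_Icc] at hr
  refine ⟨r, hr.1, hr.2, fun j h₁ h₂ hne => ?_⟩
  have hle := hmin j (Finset.mem_Icc.2 ⟨h₁, h₂⟩)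
  have hnorm : (w j).2 ≠ (w r).2 := fun h => hne (hw ⟨h₁, h₂⟩ hr h)
  rw [Prod.Lex.le_iff] at hle
  simp only [ofLex_toLex] at hle
  unfold Prec
  omega

/-- Any letter of a new norm can be inserted somewhere without changing the pinnacle set. -/
theorem exists_pin_insertLetter_eq {n : ℕ} {w : ℕ → ℕ × ℕ} {x : ℕ × ℕ}
    (hw : Set.InjOn (fun i => (w i).2) (Set.Icc 1 n))
    (hx : ∀ i, 1 ≤ i → i ≤ n → (w i).2 ≠ x.2) :
    ∃ i, 1 ≤ i ∧ i ≤ n + 1 ∧ pin (n + 1) (insertLetter w i x) = pin n w := by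
  by_cases h : ∃ i, 1 ≤ i ∧ i ≤ n ∧ Prec (w i) x
  · classical
    obtain ⟨h₁, h₂, h₃⟩ := Nat.find_spec h
    refine ⟨Nat.find h, h₁, by omega, pin_insertLetter_descent h₁ h₂ h₃ fun h₄ => ?_⟩
    have := Nat.find_min h (m := Nat.find h - 1) (by omega)
    refine (prec_or_prec (hx (Nat.find h - 1) (by omega) (by omega))).resolve_left fun h₅ =>
      this ⟨by omega, by omega, h₅⟩
  · rcases Nat.eq_zero_or_pos n with rfl | hn
    · refine ⟨1, le_rfl, le_rfl, ?_⟩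
      simp [pin]
    · obtain ⟨r, hr, hrn, hmin⟩ := exists_min_letter hn hw
      exact ⟨r + 1, by omega, by omega, pin_insertLetter_after_min hr hrn
        ((prec_or_prec (hx r hr hrn)).resolve_left fun h' => h ⟨r, hr, hrn, h'⟩) hmin⟩

/-- Deleting a first letter that exceeds its neighbor does not change the pinnacle set. -/
theorem pin_tail {n : ℕ} {w : ℕ → ℕ × ℕ} (h : 1 ≤ n → Prec (w 2) (w 1)) :
    pin n (fun i => w (i + 1)) = pin (n + 1) w := by
  ext p
  rw [mem_pin, mem_pin]
  constructor
  · rintro ⟨i, ⟨h₁, h₂, h₃, h₄⟩, rfl⟩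
    refine ⟨i + 1, ⟨by omega, by omega, ?_, h₄⟩, rfl⟩
    beta_reduce at h₃
    rwa [show i - 1 + 1 = i + 1 - 1 by omega] at h₃
  · rintro ⟨i, ⟨h₁, h₂, h₃, h₄⟩, rfl⟩
    have hi : i ≠ 2 := by
      rintro rfl
      exact h₃.asymm (h (by omega))
    obtain ⟨j, rfl⟩ : ∃ j, i = j + 1 := ⟨i - 1, by omega⟩
    refine ⟨j, ⟨by omega, by omega, ?_, h₄⟩, rfl⟩
    rwa [show j + 1 - 1 = j - 1 + 1 by omega] at h₃

/-- Deleting a last letter that exceeds its neighbor does not change the pinnacle set. -/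
theorem pin_init {n : ℕ} {w : ℕ → ℕ × ℕ} (h : 1 ≤ n → Prec (w n) (w (n + 1))) :
    pin n w = pin (n + 1) w := by
  ext p
  rw [mem_pin, mem_pin]
  refine exists_congr fun i => and_congr_left fun _ => ?_
  constructor
  · rintro ⟨h₁, h₂, h₃, h₄⟩
    exact ⟨h₁, by omega, h₃, h₄⟩
  · rintro ⟨h₁, h₂, h₃, h₄⟩
    refine ⟨h₁, ?_, h₃, h₄⟩
    have : i ≠ n := by
      rintro rfl
      exact h₄.asymm (h (by omega))
    omega

theorem injOn_insertLetter {n i : ℕ} {w : ℕ → ℕ × ℕ} {x : ℕ × ℕ}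
    (hw : Set.InjOn (fun i => (w i).2) (Set.Icc 1 n)) (hi : 1 ≤ i) (hin : i ≤ n + 1)
    (hx : ∀ i, 1 ≤ i → i ≤ n → (w i).2 ≠ x.2) :
    Set.InjOn (fun j => (insertLetter w i x j).2) (Set.Icc 1 (n + 1)) := by
  have hw' : ∀ a b, 1 ≤ a → a ≤ n → 1 ≤ b → b ≤ n → (w a).2 = (w b).2 → a = b :=
    fun a b h₁ h₂ h₃ h₄ h => hw ⟨h₁, h₂⟩ ⟨h₃, h₄⟩ h
  rintro a ⟨ha₁, ha₂⟩ b ⟨hb₁, hb₂⟩ hab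
  simp only [insertLetter] at hab
  grind

/-- Every position of `insertLetter w i x` holds `x` or a letter of `w`. -/
theorem insertLetter_cases {n i j : ℕ} (w : ℕ → ℕ × ℕ) (x : ℕ × ℕ) (hi : 1 ≤ i)
    (hin : i ≤ n + 1) (hj : 1 ≤ j) (hjn : j ≤ n + 1) :
    insertLetter w i x j = x ∨ ∃ l, 1 ≤ l ∧ l ≤ n ∧ insertLetter w i x j = w l := by
  rcases lt_trichotomy j i with h | rfl | h
  · exact .inr ⟨j, hj, by omega, insertLetter_of_lt h⟩
  · exact .inl insertLetter_self
  · obtain ⟨l, rfl⟩ : ∃ l, j = l + 1 := ⟨j - 1, by omega⟩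
    exact .inr ⟨l, by omega, by omega, insertLetter_succ (by omega)⟩

/-- If all pinnacles of a word have color at least `k`, then its letters can be recolored and
rearranged so that all colors are at least `k` and the pinnacle set is the same. -/
theorem exists_pin_eq_of_le_color {k M : ℕ} (hkM : k < M) (n : ℕ) (w : ℕ → ℕ × ℕ)
    (hw : Set.InjOn (fun i => (w i).2) (Set.Icc 1 n))
    (hM : ∀ i, 1 ≤ i → i ≤ n → (w i).1 < M) (hk : ∀ p ∈ pin n w, k ≤ p.1) :
    ∃ v : ℕ → ℕ × ℕ, Set.InjOn (fun i => (v i).2) (Set.Icc 1 n) ∧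
      (∀ i, 1 ≤ i → i ≤ n → k ≤ (v i).1 ∧ (v i).1 < M ∧
        ∃ j, 1 ≤ j ∧ j ≤ n ∧ (v i).2 = (w j).2) ∧ pin n v = pin n w := by
  induction n generalizing w with
  | zero => exact ⟨w, hw, fun i h₁ h₂ => by omega, rfl⟩
  | succ n ih =>
    obtain ⟨r, hr, hrn, hmax⟩ := exists_max_letter (by omega) hw
    by_cases hrk : k ≤ (w r).1
    · refine ⟨w, hw, fun i h₁ h₂ => ⟨?_, hM i h₁ h₂, i, h₁, h₂, rfl⟩, rfl⟩
      by_cases hir : i = r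
      · rwa [hir]
      · have := hmax i h₁ h₂ hir
        unfold Prec at this
        omega
    have hend : r = 1 ∨ r = n + 1 := by
      by_contra! hne
      refine hrk (hk _ (mem_pin.2 ⟨r, ⟨by omega, by omega, ?_, ?_⟩, rfl⟩)) <;>
        exact hmax _ (by omega) (by omega) (by omega)
    -- `u` is the word without its largest letter
    obtain ⟨u, hu, huw, hpin⟩ : ∃ u : ℕ → ℕ × ℕ, Set.InjOn (fun i => (u i).2) (Set.Icc 1 n) ∧
        (∀ i, 1 ≤ i → i ≤ n → ∃ j, 1 ≤ j ∧ j ≤ n + 1 ∧ j ≠ r ∧ u i = w j) ∧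
        pin n u = pin (n + 1) w := by
      rcases hend with rfl | rfl
      · refine ⟨fun i => w (i + 1), fun a ha b hb hab => ?_, fun i h₁ h₂ =>
          ⟨i + 1, by omega, by omega, by omega, rfl⟩,
          pin_tail fun _ => hmax 2 (by omega) (by omega) (by omega)⟩
        have := hw (x₁ := a + 1) (x₂ := b + 1) ⟨by omega, by have := ha.2; omega⟩
          ⟨by omega, by have := hb.2; omega⟩ hab
        omega
      · exact ⟨w, hw.mono (Set.Icc_subset_Icc_right (by omega)), fun i h₁ h₂ =>
          ⟨i, by omega, by omega, by omega, rfl⟩,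
          pin_init fun _ => hmax n (by omega) (by omega) (by omega)⟩
    obtain ⟨v, hv, hvu, hvpin⟩ := ih u hu
      (fun i h₁ h₂ => by
        obtain ⟨j, hj₁, hj₂, -, hj⟩ := huw i h₁ h₂
        exact hj ▸ hM j hj₁ hj₂)
      (hpin ▸ hk)
    have hvx : ∀ i, 1 ≤ i → i ≤ n → (v i).2 ≠ ((k, (w r).2) : ℕ × ℕ).2 := by
      intro i h₁ h₂ h
      obtain ⟨-, -, j, hj₁, hj₂, hj⟩ := hvu i h₁ h₂
      obtain ⟨l, hl₁, hl₂, hlr, hl⟩ := huw j hj₁ hj₂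
      exact hlr (hw ⟨hl₁, hl₂⟩ ⟨hr, hrn⟩ (by rw [hj, hl] at h; exact h))
    obtain ⟨i, hi, hin, hipin⟩ := exists_pin_insertLetter_eq hv hvx
    refine ⟨insertLetter v i (k, (w r).2), injOn_insertLetter hv hi hin hvx, fun j hj hjn => ?_,
      by rw [hipin, hvpin, hpin]⟩
    rcases insertLetter_cases v (k, (w r).2) hi hin hj hjn with h | ⟨l, hl₁, hl₂, h⟩
    · rw [h]
      exact ⟨le_rfl, hkM, r, hr, hrn, rfl⟩
    · rw [h]
      obtain ⟨h₁, h₂, a, ha₁, ha₂, ha⟩ := hvu l hl₁ hl₂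
      obtain ⟨b, hb₁, hb₂, -, hb⟩ := huw a ha₁ ha₂
      exact ⟨h₁, h₂, b, hb₁, hb₂, by rw [ha, hb]⟩

/-- `Ψ_k(APS_d(m,n)) = { P ∈ APS_d(m+k,n) : every element of P has color ≥ k }`. -/
theorem psiSet_image_APS (m n k d : ℕ) (hm : 1 ≤ m) (hn : 1 ≤ n) :
    PsiSet k '' APS m n d =
      {P | P ∈ APS (m + k) n d ∧ ∀ p ∈ P, k ≤ p.1} := by
  ext P
  constructor
  · rintro ⟨Q, ⟨⟨w, hw, rfl⟩, hd⟩, rfl⟩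
    refine ⟨⟨⟨psiWord k w, ⟨fun i hi => ⟨?_, (hw.1 i hi).2⟩, hw.2⟩, pin_psiWord k n w⟩,
      by rwa [psiSet_card]⟩, fun p hp => ?_⟩
    · exact Nat.add_lt_add_right (hw.1 i hi).1 k
    · obtain ⟨q, -, rfl⟩ := Finset.mem_image.1 hp
      exact Nat.le_add_left k q.1
  · rintro ⟨⟨⟨w, hw, rfl⟩, hd⟩, hk⟩
    obtain ⟨v, hv, hvw, hpin⟩ := exists_pin_eq_of_le_color (by omega : k < m + k) n w hw.2
      (fun i h₁ h₂ => (hw.1 i (Finset.mem_Icc.2 ⟨h₁, h₂⟩)).1) hk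
    have hpsi : PsiSet k (pin n fun i => ((v i).1 - k, (v i).2)) = pin n w := by
      rw [← pin_psiWord, ← hpin]
      refine pin_congr fun i h₁ h₂ => Prod.ext ?_ rfl
      exact Nat.sub_add_cancel (hvw i h₁ h₂).1
    refine ⟨_, ⟨⟨fun i => ((v i).1 - k, (v i).2), ⟨fun i hi => ?_, hv⟩, rfl⟩, ?_⟩, hpsi⟩
    · rw [Finset.mem_Icc] at hi
      obtain ⟨h₁, h₂, j, hj₁, hj₂, hj⟩ := hvw i hi.1 hi.2
      refine ⟨?_, ?_⟩
      · change (v i).1 - k < m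
        omega
      · change (v i).2 ∈ _
        rw [hj]
        exact (hw.1 j (Finset.mem_Icc.2 ⟨hj₁, hj₂⟩)).2
    · rwa [← psiSet_card k, hpsi]
end

section
/- Let m ≥ 2 and let P ⊆ I_n^m with #P = d, and set i₀ = #π₀(P). Then P ∈ APS_d(m,n) if and only if all of the following hold: (1) d ≤ ⌊(n−1)/2⌋; (2) the norm sets |π_i(P)|, for 0 ≤ i ≤ m−1, are pairwise disjoint; (3) the set obtained from P ∖ π₀(P) by decreasing every color by 1 and replacing every norm by its image under the unique order-preserving bijection from {1,…,n} ∖ |π₀(P)| onto {1,…,n−i₀} is an admissible pinnacle set for Z_{m−1} ≀ S_{n−i₀} of cardinality d − i₀ (i.e. it belongs to APS_{d−i₀}(m−1, n−i₀)). -/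
open Finset

/-- The unique order-preserving bijection from a finite set `D ⊆ ℕ` onto
`{1, …, #D}`, evaluated at `x`: the number of elements of `D` that are `≤ x`. -/
def rankIn (D : Finset ℕ) (x : ℕ) : ℕ :=
  (D.filter (· ≤ x)).card

theorem prec_iff_toLex_lt (p q : ℕ × ℕ) : Prec p q ↔ toLex q < toLex p := by
  rw [Prod.Lex.toLex_lt_toLex, Prec, eq_comm]

theorem Prec.trans_not_prec {p q r : ℕ × ℕ} (hpq : Prec p q) (hrq : ¬ Prec r q) :
    Prec p r := by
  rw [prec_iff_toLex_lt] at *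
  exact (not_lt.mp hrq).trans_lt hpq

/-- A finite set of a linear order can be listed in decreasing order. -/
theorem Finset.exists_decreasing_enumeration {α : Type*} [LinearOrder α] [Inhabited α]
    (S : Finset α) :
    ∃ f : ℕ → α, (∀ i j, i < j → j < S.card → f j < f i) ∧
      (∀ i < S.card, f i ∈ S) ∧ (∀ x ∈ S, ∃ i < S.card, f i = x) := by
  refine ⟨fun i => if h : i < S.card then S.orderEmbOfFin rfl (Fin.rev ⟨i, h⟩) else default,
    ?_, ?_, ?_⟩
  · intro i j hij hj
    simp only [hj, hij.trans hj, dif_pos]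
    simpa [Fin.rev_lt_rev] using hij
  · intro i hi
    simp only [hi, dif_pos]
    exact S.orderEmbOfFin_mem rfl _
  · intro x hx
    have hx' : x ∈ Set.range (S.orderEmbOfFin rfl) := by
      rw [S.range_orderEmbOfFin]; exact hx
    obtain ⟨k, rfl⟩ := hx'
    refine ⟨k.rev, k.rev.isLt, ?_⟩
    dsimp only
    rw [dif_pos k.rev.isLt, Fin.eta, Fin.rev_rev]

/-- The counting condition on a set of symbols that characterizes admissibility: its norms are
distinct, and each `p ∈ P` dominates more symbols `ξ^{m-1}(x)` with unused norm `x` than there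
are elements of `P` up to `p`. -/
def SatisfiesCount (m n : ℕ) (P : Finset (ℕ × ℕ)) : Prop :=
  (∀ p ∈ P, p.1 < m ∧ p.2 ∈ Finset.Icc 1 n) ∧ Set.InjOn Prod.snd (P : Set (ℕ × ℕ)) ∧
    ∀ p ∈ P, (P.filter (fun q => ¬ Prec p q)).card + 1 ≤
      ((Finset.Icc 1 n \ P.image Prod.snd).filter (fun x => Prec (m - 1, x) p)).card

theorem card_Icc_sdiff_norms {n : ℕ} {P : Finset (ℕ × ℕ)}
    (hP : ∀ p ∈ P, p.2 ∈ Finset.Icc 1 n) (hinj : Set.InjOn Prod.snd (P : Set (ℕ × ℕ))) :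
    (Finset.Icc 1 n \ P.image Prod.snd).card = n - P.card := by
  rw [Finset.card_sdiff_of_subset, Finset.card_image_of_injOn hinj, Nat.card_Icc]
  · simp
  · intro x hx
    obtain ⟨p, hp, rfl⟩ := Finset.mem_image.mp hx
    exact hP p hp

theorem SatisfiesCount.two_mul_card_lt {m n : ℕ} {P : Finset (ℕ × ℕ)}
    (h : SatisfiesCount m n P) : P.card = 0 ∨ 2 * P.card < n := by
  rcases P.eq_empty_or_nonempty with rfl | hne
  · simp
  right
  obtain ⟨p, hp, hmax⟩ := Finset.exists_min_image P toLex hne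
  have hcount := h.2.2 p hp
  have hall : P.filter (fun q => ¬ Prec p q) = P := by
    refine Finset.filter_true_of_mem fun q hq => ?_
    rw [prec_iff_toLex_lt]
    exact not_lt.mpr (hmax q hq)
  have hle := Finset.card_filter_le (Finset.Icc 1 n \ P.image Prod.snd)
    (fun x => Prec (m - 1, x) p)
  rw [card_Icc_sdiff_norms (fun p hp => (h.1 p hp).2) h.2.1] at hle
  rw [hall] at hcount
  omega

theorem IsAdmissible.satisfiesCount {m n : ℕ} {P : Finset (ℕ × ℕ)}
    (h : IsAdmissible m n P) : SatisfiesCount m n P := by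
  obtain ⟨w, ⟨hw, hinj⟩, rfl⟩ := h
  have hpos : ∀ p ∈ pin n w, ∃ i, (2 ≤ i ∧ i ≤ n - 1) ∧
      (Prec (w (i - 1)) (w i) ∧ Prec (w (i + 1)) (w i)) ∧ w i = p := by
    intro p hp
    simpa [pin, and_assoc] using hp
  refine ⟨?_, ?_, ?_⟩
  · intro p hp
    obtain ⟨i, hi, -, rfl⟩ := hpos p hp
    exact hw i (Finset.mem_Icc.mpr (by omega))
  · intro p hp q hq hpq
    obtain ⟨i, hi, -, rfl⟩ := hpos p hp
    obtain ⟨j, hj, -, rfl⟩ := hpos q hq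
    rw [hinj (show i ∈ Set.Icc 1 n from ⟨by omega, by omega⟩)
      (show j ∈ Set.Icc 1 n from ⟨by omega, by omega⟩) hpq]
  · intro p hp
    set S := (Finset.Icc 2 (n - 1)).filter
      (fun i => (Prec (w (i - 1)) (w i) ∧ Prec (w (i + 1)) (w i)) ∧ ¬ Prec p (w i)) with hS
    have hmemS : ∀ i, i ∈ S ↔ (2 ≤ i ∧ i ≤ n - 1) ∧
        (Prec (w (i - 1)) (w i) ∧ Prec (w (i + 1)) (w i)) ∧ ¬ Prec p (w i) := by
      intro i; simp [hS]
    have hbelow : ((pin n w).filter (fun q => ¬ Prec p q)).card ≤ S.card := by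
      refine (Finset.card_le_card ?_).trans (Finset.card_image_le (s := S) (f := w))
      intro q hq
      obtain ⟨hq, hqp⟩ := Finset.mem_filter.mp hq
      obtain ⟨i, hi, hpk, rfl⟩ := hpos q hq
      exact Finset.mem_image_of_mem _ ((hmemS i).mpr ⟨hi, hpk, hqp⟩)
    have hSne : S.Nonempty := by
      obtain ⟨i, hi, hpk, rfl⟩ := hpos p hp
      exact ⟨i, (hmemS i).mpr ⟨hi, hpk, fun h => h.asymm h⟩⟩
    set a := S.min' hSne
    have ha : a ∈ S := S.min'_mem hSne
    set T := insert (a - 1) (S.image (· + 1)) with hT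
    have hTcard : T.card = S.card + 1 := by
      rw [hT, Finset.card_insert_of_notMem, Finset.card_image_of_injective _
        (add_left_injective 1)]
      intro hmem
      obtain ⟨i, hi, hia⟩ := Finset.mem_image.mp hmem
      have := S.min'_le i hi
      change a ≤ i at this
      omega
    have hTvalley : ∀ j ∈ T, (1 ≤ j ∧ j ≤ n) ∧ Prec (w j) p ∧
        ¬ (Prec (w (j - 1)) (w j) ∧ Prec (w (j + 1)) (w j)) := by
      intro j hj
      rcases Finset.mem_insert.mp hj with rfl | hj
      · obtain ⟨hr, hpk, hle⟩ := (hmemS a).mp ha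
        refine ⟨by omega, hpk.1.trans_not_prec hle, fun hcon => ?_⟩
        have := hcon.2
        rw [show a - 1 + 1 = a by omega] at this
        exact this.asymm hpk.1
      · obtain ⟨i, hi, rfl⟩ := Finset.mem_image.mp hj
        obtain ⟨hr, hpk, hle⟩ := (hmemS i).mp hi
        refine ⟨by omega, hpk.2.trans_not_prec hle, fun hcon => ?_⟩
        have := hcon.1
        rw [show i + 1 - 1 = i by omega] at this
        exact this.asymm hpk.2
    calc _ ≤ T.card := by omega
      _ ≤ _ := by
        refine Finset.card_le_card_of_injOn (fun j => (w j).2) ?_ ?_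
        · intro j hj
          obtain ⟨hr, hlt, hnp⟩ := hTvalley j hj
          have hwj := hw j (Finset.mem_Icc.mpr hr)
          simp only [Finset.coe_filter, Set.mem_ofPred_eq, Finset.mem_sdiff]
          refine ⟨⟨hwj.2, fun hmem => ?_⟩, ?_⟩
          · obtain ⟨q, hq, hqj⟩ := Finset.mem_image.mp hmem
            obtain ⟨i, hi, hpk, rfl⟩ := hpos q hq
            have := hinj (show i ∈ Set.Icc 1 n from ⟨by omega, by omega⟩) hr hqj
            exact hnp (this ▸ hpk)
          · unfold Prec at hlt ⊢
            dsimp only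
            have := hwj.1
            omega
        · intro i hi j hj hij
          exact hinj (hTvalley i hi).1 (hTvalley j hj).1 hij

theorem SatisfiesCount.isAdmissible {m n : ℕ} (hm : 1 ≤ m) {P : Finset (ℕ × ℕ)}
    (h : SatisfiesCount m n P) : IsAdmissible m n P := by
  have hsize := h.two_mul_card_lt
  obtain ⟨hP, hinj, hcount⟩ := h
  set N := Finset.Icc 1 n \ P.image Prod.snd with hN
  have hNcard : N.card = n - P.card := card_Icc_sdiff_norms (fun p hp => (hP p hp).2) hinj
  obtain ⟨a, ha_anti, ha_mem, ha_surj⟩ := N.exists_decreasing_enumeration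
  obtain ⟨b, hb_mono, hb_mem, hb_surj⟩ : ∃ b : ℕ → ℕ × ℕ,
      (∀ i j, i < j → j < P.card → Prec (b i) (b j)) ∧
      (∀ i < P.card, b i ∈ P) ∧ (∀ x ∈ P, ∃ i < P.card, b i = x) := by
    have : Inhabited (ℕ ×ₗ ℕ) := ⟨toLex (0, 0)⟩
    obtain ⟨f, h1, h2, h3⟩ :=
      (P.map toLex.toEmbedding).exists_decreasing_enumeration (α := ℕ ×ₗ ℕ)
    rw [Finset.card_map] at h1 h2 h3
    refine ⟨fun i => ofLex (f i), ?_, ?_, ?_⟩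
    · intro i j hij hj
      rw [prec_iff_toLex_lt]
      exact h1 i j hij hj
    · intro i hi
      obtain ⟨p, hp, hpi⟩ := Finset.mem_map.mp (h2 i hi)
      dsimp only
      rw [← hpi]
      exact hp
    · intro x hx
      obtain ⟨i, hi, hix⟩ := h3 (toLex x) (Finset.mem_map_of_mem _ hx)
      exact ⟨i, hi, by dsimp only; rw [hix]; rfl⟩
  have ha_norm : ∀ i < N.card, (1 ≤ a i ∧ a i ≤ n) ∧ ∀ p ∈ P, p.2 ≠ a i := by
    intro i hi
    have := ha_mem i hi
    rw [hN, Finset.mem_sdiff, Finset.mem_Icc, Finset.mem_image] at this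
    exact ⟨this.1, fun p hp hpi => this.2 ⟨p, hp, hpi⟩⟩
  have ha_inj : ∀ i j, i < N.card → j < N.card → a i = a j → i = j := by
    intro i j hi hj hij
    rcases lt_trichotomy i j with hlt | heq | hgt
    · exact absurd hij (ha_anti i j hlt hj).ne'
    · exact heq
    · exact absurd hij (ha_anti j i hgt hi).ne
  have hb_inj : ∀ i j, i < P.card → j < P.card → (b i).2 = (b j).2 → i = j := by
    intro i j hi hj hij
    have hbij : b i = b j := hinj (hb_mem i hi) (hb_mem j hj) hij
    rcases lt_trichotomy i j with hlt | heq | hgt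
    · have := hb_mono i j hlt hj
      rw [hbij] at this
      exact absurd this this.asymm
    · exact heq
    · have := hb_mono j i hgt hi
      rw [hbij] at this
      exact absurd this this.asymm
  have hright : ∀ k < P.card, Prec (m - 1, a (k + 1)) (b k) := by
    intro k hk
    by_contra hcon
    have h1 : k + 1 ≤ (P.filter (fun q => ¬ Prec (b k) q)).card := by
      have : ((Finset.range (k + 1)).image b).card = k + 1 := by
        rw [Finset.card_image_of_injOn, Finset.card_range]
        intro i hi j hj hij
        simp only [Finset.coe_range, Set.mem_Iio] at hi hj
        exact hb_inj i j (by omega) (by omega) (by rw [hij])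
      rw [← this]
      refine Finset.card_le_card fun q hq => ?_
      obtain ⟨i, hi, rfl⟩ := Finset.mem_image.mp hq
      rw [Finset.mem_range] at hi
      refine Finset.mem_filter.mpr ⟨hb_mem i (by omega), ?_⟩
      rcases Nat.lt_succ_iff_lt_or_eq.mp hi with hik | rfl
      · exact (hb_mono i k hik hk).asymm
      · exact fun h => h.asymm h
    have h2 : (N.filter (fun x => Prec (m - 1, x) (b k))).card ≤ k + 1 := by
      calc _ ≤ ((Finset.range (k + 1)).image a).card := by
            refine Finset.card_le_card fun x hx => ?_
            obtain ⟨hx, hlt⟩ := Finset.mem_filter.mp hx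
            obtain ⟨i, hi, rfl⟩ := ha_surj x hx
            refine Finset.mem_image_of_mem _ (Finset.mem_range.mpr ?_)
            by_contra hik
            apply hcon
            rcases (show k + 1 ≤ i by omega).eq_or_lt with rfl | hki
            · exact hlt
            · exact Prec.trans (q := (m - 1, a i)) (Or.inr ⟨rfl, ha_anti _ _ hki hi⟩) hlt
        _ ≤ _ := Finset.card_image_le.trans (by simp)
    have := hcount (b k) (hb_mem k hk)
    omega
  have hleft : ∀ k < P.card, Prec (m - 1, a k) (b k) := fun k hk =>
    Prec.trans (q := (m - 1, a (k + 1)))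
      (Or.inr ⟨rfl, ha_anti k (k + 1) (by omega) (by omega)⟩) (hright k hk)
  let w : ℕ → ℕ × ℕ := fun i =>
    if i % 2 = 0 ∧ i ≤ 2 * P.card then b (i / 2 - 1)
    else if i ≤ 2 * P.card then (m - 1, a (i / 2)) else (m - 1, a (i - P.card - 1))
  have hw_peak : ∀ k < P.card, w (2 * k + 2) = b k := by
    intro k hk
    have : (2 * k + 2) / 2 - 1 = k := by omega
    simp only [w]
    rw [if_pos (by omega), this]
  have hw_valley : ∀ k ≤ P.card, w (2 * k + 1) = (m - 1, a k) := by
    intro k hk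
    simp only [w]
    rw [if_neg (by omega)]
    split_ifs with hle
    · rw [show (2 * k + 1) / 2 = k by omega]
    · rw [show 2 * k + 1 - P.card - 1 = k by omega]
  have hw_tail : ∀ k ≥ P.card, w (k + P.card + 1) = (m - 1, a k) := by
    intro k hk
    simp only [w]
    rw [if_neg (by omega), if_neg (by omega), show k + P.card + 1 - P.card - 1 = k by omega]
  have hcases : ∀ i, 1 ≤ i → i ≤ n → (∃ k < P.card, i = 2 * k + 2) ∨
      (∃ k < P.card, i = 2 * k + 1) ∨ (∃ k, P.card ≤ k ∧ k < N.card ∧ i = k + P.card + 1) := by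
    intro i h1 h2
    by_cases hi : i ≤ 2 * P.card
    · rcases Nat.mod_two_eq_zero_or_one i with h0 | h0
      · exact Or.inl ⟨i / 2 - 1, by omega, by omega⟩
      · exact Or.inr (Or.inl ⟨i / 2, by omega, by omega⟩)
    · exact Or.inr (Or.inr ⟨i - P.card - 1, by omega, by omega, by omega⟩)
  have hform : ∀ i, 1 ≤ i → i ≤ n → (∃ k < P.card, i = 2 * k + 2 ∧ w i = b k) ∨
      (∃ k < N.card, (i = 2 * k + 1 ∧ k < P.card ∨ i = k + P.card + 1 ∧ P.card ≤ k) ∧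
        w i = (m - 1, a k)) := by
    intro i h1 h2
    rcases hcases i h1 h2 with ⟨k, hk, rfl⟩ | ⟨k, hk, rfl⟩ | ⟨k, hk, hk', rfl⟩
    · exact Or.inl ⟨k, hk, rfl, hw_peak k hk⟩
    · exact Or.inr ⟨k, by omega, Or.inl ⟨rfl, hk⟩, hw_valley k hk.le⟩
    · exact Or.inr ⟨k, hk', Or.inr ⟨rfl, hk⟩, hw_tail k hk⟩
  refine ⟨w, ⟨?_, ?_⟩, ?_⟩
  · intro i hi
    rw [Finset.mem_Icc] at hi
    rcases hform i hi.1 hi.2 with ⟨k, hk, -, hwi⟩ | ⟨k, hk, -, hwi⟩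
    · rw [hwi]
      exact hP _ (hb_mem k hk)
    · rw [hwi]
      exact ⟨by dsimp only; omega, Finset.mem_Icc.mpr (ha_norm k hk).1⟩
  · intro i hi j hj hij
    dsimp only at hij
    rcases hform i hi.1 hi.2 with ⟨k, hk, hik, hwi⟩ | ⟨k, hk, hik, hwi⟩ <;>
      rcases hform j hj.1 hj.2 with ⟨l, hl, hjl, hwj⟩ | ⟨l, hl, hjl, hwj⟩ <;>
      rw [hwi, hwj] at hij
    · have := hb_inj k l hk hl hij
      omega
    · exact absurd hij ((ha_norm l hl).2 _ (hb_mem k hk))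
    · exact absurd hij.symm ((ha_norm k hk).2 _ (hb_mem l hl))
    · have := ha_inj k l hk hl hij
      omega
  · ext p
    simp only [pin, Finset.mem_image, Finset.mem_filter, Finset.mem_Icc]
    constructor
    · rintro ⟨i, ⟨hi, -, hpk⟩, rfl⟩
      rcases hcases i (by omega) (by omega) with ⟨k, hk, rfl⟩ | ⟨k, hk, rfl⟩ | ⟨k, hk, hk', rfl⟩
      · rw [hw_peak k hk]
        exact hb_mem k hk
      · rw [hw_valley k hk.le, hw_peak k hk] at hpk
        exact absurd (hleft k hk) hpk.asymm
      · rw [hw_tail k hk, show k + P.card + 1 + 1 = (k + 1) + P.card + 1 by omega,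
          hw_tail (k + 1) (by omega)] at hpk
        exact absurd (Or.inr ⟨rfl, ha_anti k (k + 1) (by omega) (by omega)⟩) hpk.asymm
    · intro hp
      obtain ⟨k, hk, rfl⟩ := hb_surj p hp
      refine ⟨2 * k + 2, ⟨by omega, ?_, ?_⟩, hw_peak k hk⟩
      · rw [hw_peak k hk, show 2 * k + 2 - 1 = 2 * k + 1 by omega, hw_valley k hk.le]
        exact hleft k hk
      · rw [hw_peak k hk, show 2 * k + 2 + 1 = 2 * (k + 1) + 1 by omega,
          hw_valley (k + 1) (by omega)]
        exact hright k hk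

theorem isAdmissible_iff_satisfiesCount {m n : ℕ} (hm : 1 ≤ m) {P : Finset (ℕ × ℕ)} :
    IsAdmissible m n P ↔ SatisfiesCount m n P :=
  ⟨IsAdmissible.satisfiesCount, SatisfiesCount.isAdmissible hm⟩

theorem rankIn_lt_rankIn {D : Finset ℕ} {x y : ℕ} (hy : y ∈ D) (hxy : x < y) :
    rankIn D x < rankIn D y := by
  refine Finset.card_lt_card ⟨fun z hz => ?_, fun hsub => ?_⟩
  · simp only [Finset.mem_filter] at hz ⊢
    exact ⟨hz.1, by omega⟩
  · have := hsub (Finset.mem_filter.mpr ⟨hy, le_rfl⟩)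
    simp only [Finset.mem_filter] at this
    omega

theorem rankIn_lt_rankIn_iff {D : Finset ℕ} {x y : ℕ} (hx : x ∈ D) (hy : y ∈ D) :
    rankIn D x < rankIn D y ↔ x < y := by
  refine ⟨fun h => ?_, rankIn_lt_rankIn hy⟩
  rcases lt_trichotomy x y with hlt | rfl | hgt
  · exact hlt
  · exact absurd h (lt_irrefl _)
  · exact absurd h (rankIn_lt_rankIn hx hgt).asymm

theorem rankIn_injOn (D : Finset ℕ) : Set.InjOn (rankIn D) (D : Set ℕ) := by
  intro x hx y hy hxy
  rcases lt_trichotomy x y with hlt | heq | hgt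
  · exact absurd hxy (rankIn_lt_rankIn hy hlt).ne
  · exact heq
  · exact absurd hxy (rankIn_lt_rankIn hx hgt).ne'

theorem image_rankIn (D : Finset ℕ) : D.image (rankIn D) = Finset.Icc 1 D.card := by
  refine Finset.eq_of_subset_of_card_le (fun y hy => ?_) ?_
  · obtain ⟨x, hx, rfl⟩ := Finset.mem_image.mp hy
    exact Finset.mem_Icc.mpr ⟨Finset.card_pos.mpr ⟨x, Finset.mem_filter.mpr ⟨hx, le_rfl⟩⟩,
      Finset.card_filter_le _ _⟩
  · rw [Finset.card_image_of_injOn (rankIn_injOn D), Nat.card_Icc]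
    omega

/-- Lowering the colors of a set of symbols with nonzero colors, and standardizing norms with
respect to `D`, does not change the counting inequalities. -/
theorem card_inequality_standardize {m : ℕ} (hm : 2 ≤ m) {D : Finset ℕ} {Q : Finset (ℕ × ℕ)}
    (hD : ∀ q ∈ Q, q.2 ∈ D) (hQ : ∀ q ∈ Q, q.1 ≠ 0) {p : ℕ × ℕ} (hp : p ∈ Q) :
    ((Q.image (fun p => (p.1 - 1, rankIn D p.2))).filter
        (fun q => ¬ Prec (p.1 - 1, rankIn D p.2) q)).card =
      (Q.filter (fun q => ¬ Prec p q)).card ∧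
    ((Finset.Icc 1 D.card \ (Q.image (fun p => (p.1 - 1, rankIn D p.2))).image Prod.snd).filter
        (fun x => Prec (m - 1 - 1, x) (p.1 - 1, rankIn D p.2))).card =
      ((D \ Q.image Prod.snd).filter (fun x => Prec (m - 1, x) p)).card := by
  have hp0 := hQ p hp
  constructor
  · have hpres : Q.filter (fun q => ¬ Prec (p.1 - 1, rankIn D p.2) (q.1 - 1, rankIn D q.2)) =
        Q.filter (fun q => ¬ Prec p q) := by
      refine Finset.filter_congr fun q hq => not_congr ?_
      have hq0 := hQ q hq
      simp only [Prec, rankIn_lt_rankIn_iff (hD q hq) (hD p hp)]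
      omega
    rw [Finset.filter_image, hpres]
    refine Finset.card_image_of_injOn fun q hq r hr hqr => ?_
    have hq' := (Finset.mem_filter.mp hq).1
    have hr' := (Finset.mem_filter.mp hr).1
    have hq0 := hQ q hq'
    have hr0 := hQ r hr'
    rw [Prod.mk.injEq] at hqr
    exact Prod.ext (by omega) (rankIn_injOn D (hD q hq') (hD r hr') hqr.2)
  · have himage : Finset.Icc 1 D.card \
        (Q.image (fun p => (p.1 - 1, rankIn D p.2))).image Prod.snd =
        (D \ Q.image Prod.snd).image (rankIn D) := by
      rw [← image_rankIn, Finset.image_sdiff_of_injOn (rankIn_injOn D), Finset.image_image,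
        Finset.image_image]
      · rfl
      · intro x hx
        obtain ⟨q, hq, rfl⟩ := Finset.mem_image.mp hx
        exact hD q hq
    have hpres : (D \ Q.image Prod.snd).filter
          (fun x => Prec (m - 1 - 1, rankIn D x) (p.1 - 1, rankIn D p.2)) =
        (D \ Q.image Prod.snd).filter (fun x => Prec (m - 1, x) p) := by
      refine Finset.filter_congr fun x hx => ?_
      simp only [Prec, rankIn_lt_rankIn_iff (hD p hp) (Finset.mem_sdiff.mp hx).1]
      omega
    rw [himage, Finset.filter_image, hpres]
    refine Finset.card_image_of_injOn ((rankIn_injOn D).mono fun x hx => ?_)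
    exact (Finset.mem_sdiff.mp (Finset.mem_filter.mp hx).1).1

theorem injOn_snd_iff_disjoint_norms (P : Finset (ℕ × ℕ)) :
    Set.InjOn Prod.snd (P : Set (ℕ × ℕ)) ↔ ∀ i j : ℕ, i ≠ j →
      Disjoint ((P.filter (fun p => p.1 = i)).image Prod.snd)
        ((P.filter (fun p => p.1 = j)).image Prod.snd) := by
  constructor
  · intro h i j hij
    rw [Finset.disjoint_left]
    intro x hx hx'
    obtain ⟨p, hp, rfl⟩ := Finset.mem_image.mp hx
    obtain ⟨q, hq, hqp⟩ := Finset.mem_image.mp hx'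
    obtain ⟨hpP, rfl⟩ := Finset.mem_filter.mp hp
    obtain ⟨hqP, rfl⟩ := Finset.mem_filter.mp hq
    exact hij (by rw [h hqP hpP hqp])
  · intro h p hp q hq hpq
    refine Prod.ext (by_contra fun hne => ?_) hpq
    refine Finset.disjoint_left.mp (h p.1 q.1 hne)
      (Finset.mem_image_of_mem _ (Finset.mem_filter.mpr ⟨hp, rfl⟩)) ?_
    rw [hpq]
    exact Finset.mem_image_of_mem _ (Finset.mem_filter.mpr ⟨hq, rfl⟩)

/-- Characterization of admissibility in terms of the color-0 part `π₀(P)`. -/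
theorem admissible_iff_pi0 (m n d : ℕ) (hm : 2 ≤ m) (hn : 1 ≤ n)
    (P : Finset (ℕ × ℕ)) (hPsub : ∀ p ∈ P, p.1 < m ∧ 1 ≤ p.2 ∧ p.2 ≤ n)
    (hd : P.card = d) :
    P ∈ APS m n d ↔
      d ≤ (n - 1) / 2 ∧
      (∀ i j : ℕ, i ≠ j →
        Disjoint ((P.filter (fun p => p.1 = i)).image Prod.snd)
          ((P.filter (fun p => p.1 = j)).image Prod.snd)) ∧
      ((P.filter (fun p => p.1 ≠ 0)).image
          (fun p => (p.1 - 1,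
            rankIn (Finset.Icc 1 n \ ((P.filter (fun q => q.1 = 0)).image Prod.snd)) p.2)))
        ∈ APS (m - 1) (n - (P.filter (fun q => q.1 = 0)).card)
            (d - (P.filter (fun q => q.1 = 0)).card) := by
  rw [← injOn_snd_iff_disjoint_norms]
  set Q := P.filter (fun p => p.1 ≠ 0) with hQ
  set Z := P.filter (fun q => q.1 = 0) with hZ
  set D := Finset.Icc 1 n \ Z.image Prod.snd with hD
  have hZinj : Set.InjOn Prod.snd (Z : Set (ℕ × ℕ)) := by
    intro p hp q hq hpq
    have hp0 := (Finset.mem_filter.mp hp).2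
    have hq0 := (Finset.mem_filter.mp hq).2
    exact Prod.ext (hp0.trans hq0.symm) hpq
  have hnorm : ∀ p ∈ P, p.2 ∈ Finset.Icc 1 n := fun p hp => Finset.mem_Icc.mpr (hPsub p hp).2
  have hDcard : D.card = n - Z.card :=
    card_Icc_sdiff_norms (fun p hp => hnorm p (Finset.mem_filter.mp hp).1) hZinj
  have hsum : Z.card + Q.card = P.card := Finset.card_filter_add_card_filter_not _
  have hcard : (Q.image (fun p => (p.1 - 1, rankIn D p.2))).card ≤ d - Z.card :=
    Finset.card_image_le.trans (by omega)
  simp only [APS, Set.mem_ofPred_eq, hcard, hd.le, and_true]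
  rw [isAdmissible_iff_satisfiesCount (by omega), isAdmissible_iff_satisfiesCount (by omega),
    ← hDcard]
  have hQ0 : ∀ q ∈ Q, q.1 ≠ 0 := fun q hq => (Finset.mem_filter.mp hq).2
  have hQP : ∀ q ∈ Q, q ∈ P := fun q hq => (Finset.mem_filter.mp hq).1
  have hQD : Set.InjOn Prod.snd (P : Set (ℕ × ℕ)) → ∀ q ∈ Q, q.2 ∈ D := by
    intro hinj q hq
    refine Finset.mem_sdiff.mpr ⟨hnorm q (hQP q hq), fun hmem => ?_⟩
    obtain ⟨z, hz, hzq⟩ := Finset.mem_image.mp hmem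
    obtain ⟨hzP, hz0⟩ := Finset.mem_filter.mp hz
    exact hQ0 q hq (hinj hzP (hQP q hq) hzq ▸ hz0)
  have hunused : D \ Q.image Prod.snd = Finset.Icc 1 n \ P.image Prod.snd := by
    rw [hD, sdiff_sdiff_left, Finset.sup_eq_union, ← Finset.image_union, hZ, hQ,
      Finset.filter_union_filter_not_eq]
  have hbelow : ∀ p ∈ Q, P.filter (fun q => ¬ Prec p q) = Q.filter (fun q => ¬ Prec p q) := by
    intro p hp
    ext q
    have hp0 := hQ0 p hp
    simp only [hQ, Finset.mem_filter, and_assoc, and_congr_right_iff, iff_and_self]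
    intro _ hpq hq0
    exact hpq (Or.inl (by omega))
  constructor
  · intro h
    have hinj := h.2.1
    refine ⟨?_, hinj, ?_, ?_, ?_⟩
    · have := h.two_mul_card_lt
      omega
    · intro p' hp'
      obtain ⟨p, hp, rfl⟩ := Finset.mem_image.mp hp'
      refine ⟨?_, ?_⟩
      · have h1 := (hPsub p (hQP p hp)).1
        have h2 := hQ0 p hp
        dsimp only
        omega
      · rw [← image_rankIn]
        exact Finset.mem_image_of_mem _ (hQD hinj p hp)
    · intro p' hp' q' hq' hpq
      obtain ⟨p, hp, rfl⟩ := Finset.mem_image.mp hp'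
      obtain ⟨q, hq, rfl⟩ := Finset.mem_image.mp hq'
      rw [hinj (hQP p hp) (hQP q hq) (rankIn_injOn D (hQD hinj p hp) (hQD hinj q hq) hpq)]
    · intro p' hp'
      obtain ⟨p, hp, rfl⟩ := Finset.mem_image.mp hp'
      obtain ⟨h1, h2⟩ := card_inequality_standardize hm (hQD hinj) hQ0 hp
      rw [h1, h2, hunused, ← hbelow p hp]
      exact h.2.2 p (hQP p hp)
  · rintro ⟨hle, hinj, h⟩
    refine ⟨fun p hp => ⟨(hPsub p hp).1, hnorm p hp⟩, hinj, fun p hp => ?_⟩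
    by_cases hp0 : p.1 = 0
    · have hall : (Finset.Icc 1 n \ P.image Prod.snd).filter (fun x => Prec (m - 1, x) p) =
          Finset.Icc 1 n \ P.image Prod.snd :=
        Finset.filter_true_of_mem fun x _ => Or.inl (by dsimp only; omega)
      rw [hall, card_Icc_sdiff_norms hnorm hinj]
      have := Finset.card_filter_le P (fun q => ¬ Prec p q)
      omega
    · have hpQ : p ∈ Q := Finset.mem_filter.mpr ⟨hp, hp0⟩
      obtain ⟨h1, h2⟩ := card_inequality_standardize hm (hQD hinj) hQ0 hpQ
      have := h.2.2 _ (Finset.mem_image_of_mem _ hpQ)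
      rwa [h1, h2, hunused, ← hbelow p hpQ] at this
end
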